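/- Let k be a field of characteristic zero, let R be a commutative k-algebra with an ideal m such that m^{n+1} = 0 for some natural number n and the composite k → R → R/m is bijective, and let B be a commutative k-algebra. Let θ : B ⊗_k R → B ⊗_k R be an R-algebra homomorphism such that θ(x ⊗ 1) − x ⊗ 1 lies in B ⊗ m (the kernel of the reduction B ⊗_k R → B ⊗_k (R/m)) for every x ∈ B. Then there exists an R-linear map T : B ⊗_k R → B ⊗_k R which is a derivation (T(uv) = u·T(v) + v·T(u) for all u, v) with image contained in B ⊗ m, such that θ = Σ_{i=0}^{n} (1/i!)·Tⁱ; such a T automatically satisfies T^{n+1} = 0, so the sum is exhaustive, i.e. θ = exp(T). -/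

import Mathlib

open scoped TensorProduct

namespace IsNilpotent

theorem exp_eq_one_add_add_sq_mul {S : Type*} [CommRing S] [Algebra ℚ S] {a : S}
    (ha : IsNilpotent a) : ∃ w, exp a = 1 + a + a ^ 2 * w := by
  obtain ⟨N, hN⟩ := ha
  have h : a ^ (N + 2) = 0 := by rw [pow_add, hN, zero_mul]
  refine ⟨∑ i ∈ Finset.range N, ((i + 2).factorial : ℚ)⁻¹ • a ^ i, ?_⟩
  rw [exp_eq_sum h, Finset.sum_range_succ', Finset.sum_range_succ', Finset.mul_sum]
  simp only [mul_smul_comm, ← pow_add]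
  simp [add_comm 2]
  ring

theorem exists_dvd_exp_eq_one_add_of_pow_dvd {S : Type*} [CommRing S] [Algebra ℚ S] {x : S}
    {N : ℕ} (hx : x ^ N = 0) (d : ℕ) :
    ∀ j, 1 ≤ j → N ≤ j + d → ∀ y, x ^ j ∣ y → ∃ t, x ∣ t ∧ exp t = 1 + y := by
  induction d with
  | zero =>
    intro j _ hNj y hy
    rw [pow_eq_zero_of_le (by omega : N ≤ j) hx, zero_dvd_iff] at hy
    exact ⟨0, dvd_zero x, by simp [hy]⟩
  | succ d ih =>
    intro j hj hNj y hy
    have hxy : x ∣ y := (dvd_pow_self x (by omega)).trans hy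
    have nil_of_dvd {z : S} (hz : x ∣ z) : IsNilpotent z :=
      ⟨N, zero_dvd_iff.1 (hx ▸ pow_dvd_pow_of_dvd hz N)⟩
    obtain ⟨w, hw⟩ := exp_eq_one_add_add_sq_mul (nil_of_dvd hxy).neg
    have hdvd : x ^ (j + 1) ∣ y ^ 2 * (w * (1 + y) - 1) := by
      refine Dvd.dvd.mul_right ?_ _
      rw [_root_.pow_succ, sq]
      exact mul_dvd_mul hy hxy
    obtain ⟨t, hxt, ht⟩ := ih (j + 1) (by omega) (by omega) _ hdvd
    refine ⟨t + y, dvd_add hxt hxy, ?_⟩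
    have hy' : 1 + y ^ 2 * (w * (1 + y) - 1) = exp (-y) * (1 + y) := by
      rw [hw]; ring
    rw [exp_add_of_commute (Commute.all _ _) (nil_of_dvd hxt) (nil_of_dvd hxy), ht, hy',
      mul_right_comm, exp_neg_mul_exp_self (nil_of_dvd hxy), one_mul]

theorem exists_exp_mul_eq_one_add {A : Type*} [Ring A] [Algebra ℚ A] {x : A}
    (hx : IsNilpotent x) : ∃ q ∈ Algebra.adjoin ℚ {x}, IsNilpotent (x * q) ∧
      exp (x * q) = 1 + x := by
  have := Algebra.isMulCommutative_adjoin ℚ (s := {x}) (by simp)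
  obtain ⟨N, hN⟩ := hx
  let y : Algebra.adjoin ℚ {x} := ⟨x, Algebra.self_mem_adjoin_singleton ℚ x⟩
  have hy : y ^ N = 0 := Subtype.ext (by simpa [y] using hN)
  obtain ⟨t, ⟨q, rfl⟩, ht⟩ :=
    exists_dvd_exp_eq_one_add_of_pow_dvd hy N 1 le_rfl (by omega) y (by simp)
  have hyq : IsNilpotent (y * q) := ⟨N, by rw [mul_pow, hy, zero_mul]⟩
  refine ⟨q, q.2, hyq.map (Algebra.adjoin ℚ {x}).val, ?_⟩
  have := hyq.map_exp (Algebra.adjoin ℚ {x}).val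
  rw [ht] at this
  simpa [y] using this.symm

theorem exp_nsmul {A : Type*} [Ring A] [Module ℚ A] {a : A} (ha : IsNilpotent a) (N : ℕ) :
    exp (N • a) = exp a ^ N := by
  induction N with
  | zero => simp
  | succ N ih =>
    rw [succ_nsmul, exp_add_of_commute ((Commute.refl a).smul_left N) (ha.smul N) ha, ih,
      _root_.pow_succ]

end IsNilpotent

theorem Polynomial.eq_zero_of_forall_eval_natCast_eq_zero {A : Type*} [CommRing A] [Algebra ℚ A]
    {P : Polynomial A} (h : ∀ N : ℕ, P.eval (N : A) = 0) : P = 0 := by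
  ext i
  rw [coeff_zero, ← Module.forall_dual_apply_eq_zero_iff ℚ]
  intro f
  let p : Polynomial ℚ := ∑ j ∈ P.support, monomial j (f (P.coeff j))
  have hp : p = 0 := by
    refine eq_of_infinite_eval_eq p 0
      ((Set.infinite_range_of_injective (Nat.cast_injective (R := ℚ))).mono ?_)
    rintro _ ⟨N, rfl⟩
    have hN := congrArg f (h N)
    have hterm (j : ℕ) : f (P.coeff j * (N : A) ^ j) = f (P.coeff j) * (N : ℚ) ^ j := by
      rw [mul_comm, ← Nat.cast_pow, ← nsmul_eq_mul, map_nsmul, nsmul_eq_mul, Nat.cast_pow,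
        mul_comm]
    rw [eval_eq_sum, sum_def, map_sum, map_zero] at hN
    simpa [p, eval_finsetSum, hterm] using hN
  have hi := congrArg (coeff · i) hp
  simp only [p, finsetSum_coeff, coeff_monomial, Finset.sum_ite_eq', coeff_zero] at hi
  split_ifs at hi with his
  · exact hi
  · rw [notMem_support_iff.1 his, map_zero]

theorem Module.End.map_mul_of_exp_map_mul {k A : Type*} [CommRing k] [CommRing A] [Algebra k A]
    [Algebra ℚ A] {T : Module.End k A} (hT : IsNilpotent T)
    (h : ∀ u v, IsNilpotent.exp T (u * v) = IsNilpotent.exp T u * IsNilpotent.exp T v)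
    (u v : A) : T (u * v) = u * T v + v * T u := by
  obtain ⟨n, hn⟩ := id hT
  have hn2 : T ^ (n + 2) = 0 := by rw [pow_add, hn, zero_mul]
  have hpow (N : ℕ) (u v : A) : (IsNilpotent.exp T ^ N) (u * v) =
      (IsNilpotent.exp T ^ N) u * (IsNilpotent.exp T ^ N) v := by
    induction N with
    | zero => simp
    | succ N ih => simp only [pow_succ', Module.End.mul_apply, ih, h]
  let P (w : A) : Polynomial A := ∑ i ∈ Finset.range (n + 2),
    Polynomial.monomial i ((i.factorial : ℚ)⁻¹ • (T ^ i) w)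
  have hP (w : A) (N : ℕ) : (P w).eval (N : A) = (IsNilpotent.exp T ^ N) w := by
    have hN : (N • T) ^ (n + 2) = 0 := by rw [smul_pow, hn2, smul_zero]
    rw [← IsNilpotent.exp_nsmul hT, IsNilpotent.exp_eq_sum hN, LinearMap.sum_apply,
      Polynomial.eval_finsetSum]
    refine Finset.sum_congr rfl fun i _ => ?_
    rw [smul_pow, LinearMap.smul_apply, LinearMap.smul_apply, smul_comm, Polynomial.eval_monomial,
      ← Nat.cast_pow, nsmul_eq_mul, mul_comm]
  have hP0 (w : A) : (P w).coeff 0 = w := by simp [P, Polynomial.coeff_monomial]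
  have hP1 (w : A) : (P w).coeff 1 = T w := by simp [P, Polynomial.coeff_monomial]
  have hPmul : P (u * v) - P u * P v = 0 :=
    Polynomial.eq_zero_of_forall_eval_natCast_eq_zero fun N => by simp [hP, hpow]
  have := congrArg (Polynomial.coeff · 1) (sub_eq_zero.1 hPmul)
  simp only [Polynomial.mul_coeff_one, hP0, hP1] at this
  rw [this]
  ring

/-- An algebra endomorphism that differs from the identity by a nilpotent map is the exponential
of a nilpotent derivation, which commutes with everything the endomorphism commutes with. -/
theorem AlgHom.exists_exp_eq_of_isNilpotent_sub_one {k A : Type*} [CommRing k] [CommRing A]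
    [Algebra k A] [Algebra ℚ A] (θ : A →ₐ[k] A) {D : Module.End k A}
    (hD : ∀ u, D u = θ u - u) (hnil : IsNilpotent D) :
    ∃ q : Module.End k A, (∀ L, Commute D L → Commute q L) ∧ IsNilpotent (D * q) ∧
      IsNilpotent.exp (D * q) = θ.toLinearMap ∧
      ∀ u v, (D * q) (u * v) = u * (D * q) v + v * (D * q) u := by
  let : Algebra ℚ (Module.End k A) := Algebra.ofModule smul_mul_assoc mul_smul_comm
  obtain ⟨q, hq, hDq, hexp⟩ := IsNilpotent.exists_exp_mul_eq_one_add hnil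
  have hθ : IsNilpotent.exp (D * q) = θ.toLinearMap := by
    rw [hexp]
    ext u
    simp [hD]
  refine ⟨q, fun L hL => ?_, hDq, hθ, Module.End.map_mul_of_exp_map_mul hDq fun u v => by simp [hθ]⟩
  exact (Algebra.commute_of_mem_adjoin_singleton_of_commute hq hL.symm).symm

section

variable {k R B : Type*} [Field k] [CommRing R] [Algebra k R] [CommRing B] [Algebra k B]

open Algebra.TensorProduct in
theorem Algebra.TensorProduct.mem_map_includeRight_iff_mem_span (m : Ideal R) (w : B ⊗[k] R) :
    w ∈ m.map (includeRight : R →ₐ[k] B ⊗[k] R) ↔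
      w ∈ Submodule.span k {w : B ⊗[k] R | ∃ (z : B) (a : R), a ∈ m ∧ w = z ⊗ₜ[k] a} := by
  constructor
  · intro hw
    refine Submodule.span_induction (p := fun w _ => w ∈ Submodule.span k
      {w : B ⊗[k] R | ∃ (z : B) (a : R), a ∈ m ∧ w = z ⊗ₜ[k] a}) ?_ (zero_mem _)
      (fun _ _ _ _ => add_mem) ?_ hw
    · rintro _ ⟨a, ha, rfl⟩
      exact Submodule.subset_span ⟨1, a, ha, rfl⟩
    · intro u w hw' hw
      clear hw'
      induction hw using Submodule.span_induction with
      | zero => simp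
      | add x y _ _ hx hy => rw [smul_add]; exact add_mem hx hy
      | smul c x _ hx => rw [smul_comm]; exact Submodule.smul_mem _ c hx
      | mem x hx =>
        obtain ⟨z, a, ha, rfl⟩ := hx
        induction u with
        | zero => simp
        | add x y hx hy => rw [add_smul]; exact add_mem hx hy
        | tmul b r =>
          exact Submodule.subset_span ⟨b * z, r * a, m.mul_mem_left r ha, by simp⟩
  · intro hw
    refine (Submodule.span_le (p := (m.map (includeRight : R →ₐ[k] B ⊗[k] R)).restrictScalars k)).2
      ?_ hw
    rintro _ ⟨z, a, ha, rfl⟩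
    have : z ⊗ₜ[k] a = (z ⊗ₜ[k] 1 : B ⊗[k] R) * includeRight (R := k) (A := B) a := by simp
    simp only [Submodule.coe_restrictScalars, SetLike.mem_coe, this]
    exact Ideal.mul_mem_left _ _ (Ideal.mem_map_of_mem _ ha)

open Algebra.TensorProduct in
/-- A right-linear map with values in `B ⊗ m` raises the `m`-adic filtration. -/
theorem Algebra.TensorProduct.pow_apply_mem_map_pow {m : Ideal R} {D : Module.End k (B ⊗[k] R)}
    (hlin : ∀ (r : R) (u : B ⊗[k] R), D ((1 ⊗ₜ[k] r) * u) = (1 ⊗ₜ[k] r) * D u)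
    (hmem : ∀ u, D u ∈ m.map (includeRight : R →ₐ[k] B ⊗[k] R)) (j : ℕ) (u : B ⊗[k] R) :
    (D ^ j) u ∈ (m ^ j).map (includeRight : R →ₐ[k] B ⊗[k] R) := by
  induction j with
  | zero => simp [Ideal.one_eq_top, Ideal.map_top]
  | succ j ih =>
    rw [Module.End.pow_apply, Function.iterate_succ_apply', ← Module.End.pow_apply]
    generalize (D ^ j) u = w at ih
    replace ih := (mem_map_includeRight_iff_mem_span _ _).1 ih
    induction ih using Submodule.span_induction with
    | zero => simp
    | add x y _ _ hx hy => rw [map_add]; exact add_mem hx hy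
    | smul c x _ hx => rw [map_smul]; exact Submodule.smul_of_tower_mem _ c hx
    | mem x hx =>
      obtain ⟨z, a, ha, rfl⟩ := hx
      have : z ⊗ₜ[k] a = ((1 : B) ⊗ₜ[k] a) * (z ⊗ₜ[k] (1 : R)) := by simp
      rw [this, hlin, _root_.pow_succ, Ideal.map_mul]
      exact Ideal.mul_mem_mul (Ideal.mem_map_of_mem includeRight ha) (hmem _)

end

/-- Every `R`-algebra endomorphism of the trivial deformation `B ⊗ R` which is the identity
modulo the nilpotent maximal ideal `m` of `R` is the exponential of a derivation with values
in `B ⊗ m`. -/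
theorem stmt14 (k R B : Type*) [Field k] [CharZero k] [CommRing R] [Algebra k R]
    [CommRing B] [Algebra k B]
    (m : Ideal R) (n : ℕ) (hm : m ^ (n + 1) = ⊥)
    (hres : Function.Bijective ((Ideal.Quotient.mk m).comp (algebraMap k R)))
    (θ : (B ⊗[k] R) →+* (B ⊗[k] R))
    (hθR : ∀ r : R, θ ((1 : B) ⊗ₜ[k] r) = (1 : B) ⊗ₜ[k] r)
    (hθid : ∀ x : B, θ (x ⊗ₜ[k] 1) - x ⊗ₜ[k] 1 ∈
      Submodule.span k {w : B ⊗[k] R | ∃ (z : B) (a : R), a ∈ m ∧ w = z ⊗ₜ[k] a}) :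
    ∃ T : (B ⊗[k] R) →ₗ[k] (B ⊗[k] R),
      (∀ (r : R) (u : B ⊗[k] R), T (((1 : B) ⊗ₜ[k] r) * u) = ((1 : B) ⊗ₜ[k] r) * T u) ∧
      (∀ u v : B ⊗[k] R, T (u * v) = u * T v + v * T u) ∧
      (∀ u : B ⊗[k] R,
        T u ∈ Submodule.span k {w : B ⊗[k] R | ∃ (z : B) (a : R), a ∈ m ∧ w = z ⊗ₜ[k] a}) ∧
      (∀ u : B ⊗[k] R,
        θ u = ∑ i ∈ Finset.range (n + 1), ((Nat.factorial i : k)⁻¹) • (T ^ i) u) ∧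
      T ^ (n + 1) = 0 := by
  let : Algebra ℚ (B ⊗[k] R) :=
    ((algebraMap k (B ⊗[k] R)).comp (algebraMap ℚ k)).toAlgebra
  have hθk (c : k) : θ (algebraMap k (B ⊗[k] R) c) = algebraMap k (B ⊗[k] R) c := by
    rw [Algebra.TensorProduct.algebraMap_apply, Algebra.algebraMap_eq_smul_one,
      TensorProduct.smul_tmul, hθR]
  let θ' : B ⊗[k] R →ₐ[k] B ⊗[k] R := { θ with commutes' := hθk }
  let D : Module.End k (B ⊗[k] R) := θ'.toLinearMap - 1
  have hD (u) : D u = θ u - u := rfl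
  have hlin (r : R) (u : B ⊗[k] R) : D ((1 ⊗ₜ[k] r) * u) = (1 ⊗ₜ[k] r) * D u := by
    rw [hD, hD, map_mul, hθR, mul_sub]
  have hmem (u : B ⊗[k] R) :
      D u ∈ m.map (Algebra.TensorProduct.includeRight : R →ₐ[k] B ⊗[k] R) := by
    induction u with
    | zero => simp
    | add x y hx hy => rw [map_add]; exact add_mem hx hy
    | tmul b r =>
      have : b ⊗ₜ[k] r = ((1 : B) ⊗ₜ[k] r) * (b ⊗ₜ[k] (1 : R)) := by simp
      rw [this, hlin]
      exact Ideal.mul_mem_left _ _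
        ((Algebra.TensorProduct.mem_map_includeRight_iff_mem_span _ _).2 (hθid b))
  have hDn : D ^ (n + 1) = 0 := by
    refine LinearMap.ext fun u => ?_
    have := Algebra.TensorProduct.pow_apply_mem_map_pow hlin hmem (n + 1) u
    rw [hm, Ideal.map_bot] at this
    exact this
  obtain ⟨q, hq, hnil, hexp, hder⟩ :=
    θ'.exists_exp_eq_of_isNilpotent_sub_one hD ⟨n + 1, hDn⟩
  have hTn : (D * q) ^ (n + 1) = 0 := by
    rw [(hq D (Commute.refl D)).symm.mul_pow, hDn, zero_mul]
  refine ⟨D * q, fun r u => ?_, hder, fun u => ?_, fun u => ?_, hTn⟩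
  · have hL : Commute D (LinearMap.mulLeft k ((1 : B) ⊗ₜ[k] r)) := LinearMap.ext (hlin r)
    exact LinearMap.congr_fun (hL.mul_left (hq _ hL)) u
  · exact (Algebra.TensorProduct.mem_map_includeRight_iff_mem_span _ _).1 (hmem (q u))
  · have hu := LinearMap.congr_fun hexp u
    rw [IsNilpotent.exp_eq_sum hTn, LinearMap.sum_apply] at hu
    refine hu.symm.trans (Finset.sum_congr rfl fun i _ => ?_)
    rw [LinearMap.smul_apply, ← Rat.cast_smul_eq_qsmul k]
    simp
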